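/- Let (Ω, μ) be a probability space, n, T positive natural numbers, and for each user i = 1,…,n and day t = 1,…,T let X_{i,t}, Y_{i,t} : Ω → ℝ be integrable random variables, with fixed PV areas a_i ≥ 0. Let β_1,…,β_T ∈ [0,1] and let π_B ≥ 0, π_in ∈ ℝ, and π_out, π_grid, π_rev be real constants with π_out ≥ π_grid ≥ 0 and π_rev ≥ 0. For C = (C_1,…,C_n) ∈ ℝⁿ define S(C) = Σ_i C_i, and for each t and ω define m_{i,t}(ω) = max(X_{i,t}(ω) − a_i·Y_{i,t}(ω), 0), q_t(ω) = Σ_i max(a_i·Y_{i,t}(ω) − X_{i,t}(ω), 0) and P_{out,t}(C, ω) = Σ_i min(m_{i,t}(ω), C_i). Then the manager's expected cost J_a(C) = π_B·S(C) + Σ_{t=1}^{T} ∫ [ π_in·q_t(ω) − π_out·P_{out,t}(C, ω) + π_grid·max(P_{out,t}(C, ω) − q_t(ω) − β_t·S(C), 0) + π_rev·max(q_t(ω) − P_{out,t}(C, ω) − (1−β_t)·S(C), 0) ] dμ(ω) is convex on the set {C ∈ ℝⁿ : C_i ≥ 0 for all i}. -/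

import Mathlib

open MeasureTheory

/-- The integral of a pointwise convex family of integrable functions is convex. -/
theorem ConvexOn.integral_of_forall {Ω E : Type*} [MeasurableSpace Ω] {μ : Measure Ω}
    [AddCommMonoid E] [Module ℝ E] {s : Set E} (hs : Convex ℝ s) {f : E → Ω → ℝ}
    (hf : ∀ ω, ConvexOn ℝ s fun x => f x ω) (hint : ∀ x, Integrable (f x) μ) :
    ConvexOn ℝ s fun x => ∫ ω, f x ω ∂μ := by
  refine ⟨hs, fun x hx y hy u v hu hv huv => ?_⟩
  simp only [smul_eq_mul]
  rw [← integral_const_mul, ← integral_const_mul,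
    ← integral_add ((hint x).const_mul u) ((hint y).const_mul v)]
  exact integral_mono (hint _) (((hint x).const_mul u).add ((hint y).const_mul v))
    fun ω => (hf ω).2 hx hy hu hv huv

/-- The total `∑ i, min (m i) (C i)` is a concave function of `C`. -/
theorem concaveOn_sum_min {ι : Type*} [Fintype ι] {s : Set (ι → ℝ)} (hs : Convex ℝ s)
    (m : ι → ℝ) : ConcaveOn ℝ s fun C => ∑ i, min (m i) (C i) := by
  have hmin (i : ι) : ConcaveOn ℝ s fun C => min (m i) (C i) :=
    (concaveOn_const (m i) hs).inf ((LinearMap.proj (R := ℝ) i).concaveOn hs)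
  refine ⟨hs, fun x hx y hy u v hu hv huv => ?_⟩
  simp only [smul_eq_mul, Finset.mul_sum]
  rw [← Finset.sum_add_distrib]
  exact Finset.sum_le_sum fun i _ => (hmin i).2 hx hy hu hv huv

/-- The daily cost is convex when the power sold `P` and the capacity `S` are concave:
it is jointly convex in `(P, S)` and, as `πgrid ≤ πout`, nonincreasing in each. -/
theorem convexOn_daily_cost {E : Type*} [AddCommMonoid E] [Module ℝ E] {s : Set E}
    {P S : E → ℝ} (hP : ConcaveOn ℝ s P) (hS : ConcaveOn ℝ s S)
    {b πout πgrid πrev : ℝ} (πin q : ℝ) (hb : b ∈ Set.Icc (0 : ℝ) 1)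
    (h1 : πgrid ≤ πout) (h2 : 0 ≤ πgrid) (h3 : 0 ≤ πrev) :
    ConvexOn ℝ s fun x => πin * q - πout * P x + πgrid * max (P x - q - b * S x) 0 +
      πrev * max (q - P x - (1 - b) * S x) 0 := by
  have hconst (c : ℝ) : ConvexOn ℝ s fun _ => c := convexOn_const c hP.1
  have hgrid : ConvexOn ℝ s fun x => max (-q + -(b * S x)) (-P x) :=
    ((hconst (-q)).add (hS.smul hb.1).neg).sup hP.neg
  have hrev : ConvexOn ℝ s fun x => max (q + -P x + -((1 - b) * S x)) 0 :=
    (((hconst q).add hP.neg).add (hS.smul (sub_nonneg.2 hb.2)).neg).sup (hconst 0)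
  refine ((((hconst (πin * q)).add (hP.neg.smul (sub_nonneg.2 h1))).add (hgrid.smul h2)).add
    (hrev.smul h3)).congr fun x _ => ?_
  have hmax : max (P x - q - b * S x) 0 = P x + max (-q + -(b * S x)) (-P x) := by
    rw [← max_add_add_left]
    congr 1 <;> ring
  simp only [Pi.add_apply, Pi.neg_apply, smul_eq_mul, hmax]
  ring_nf

/-- Convexity of the manager's total expected cost in Scenario 2 (Lemma 3 of the paper). -/
theorem manager_cost_convex
    {Ω : Type*} [MeasurableSpace Ω] (μ : Measure Ω) [IsProbabilityMeasure μ]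
    (n T : ℕ) (hn : 0 < n) (hT : 0 < T)
    (X Y : Fin n → Fin T → Ω → ℝ)
    (hX : ∀ i t, Integrable (X i t) μ) (hY : ∀ i t, Integrable (Y i t) μ)
    (a : Fin n → ℝ) (ha : ∀ i, 0 ≤ a i)
    (β : Fin T → ℝ) (hβ : ∀ t, β t ∈ Set.Icc (0 : ℝ) 1)
    (πB πin πout πgrid πrev : ℝ)
    (hB : 0 ≤ πB) (h1 : πout ≥ πgrid) (h2 : 0 ≤ πgrid) (h3 : 0 ≤ πrev) :
    ConvexOn ℝ {C : Fin n → ℝ | ∀ i, 0 ≤ C i}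
      (fun C : Fin n → ℝ =>
        πB * (∑ i : Fin n, C i) +
          ∑ t : Fin T,
            ∫ ω,
              (πin * (∑ i : Fin n, max (a i * Y i t ω - X i t ω) 0) -
                πout * (∑ i : Fin n, min (max (X i t ω - a i * Y i t ω) 0) (C i)) +
                πgrid *
                  max ((∑ i : Fin n, min (max (X i t ω - a i * Y i t ω) 0) (C i)) -
                      (∑ i : Fin n, max (a i * Y i t ω - X i t ω) 0) -
                      β t * (∑ i : Fin n, C i)) 0 +
                πrev *
                  max ((∑ i : Fin n, max (a i * Y i t ω - X i t ω) 0) -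
                      (∑ i : Fin n, min (max (X i t ω - a i * Y i t ω) 0) (C i)) -
                      (1 - β t) * (∑ i : Fin n, C i)) 0) ∂μ) := by
  have hs : Convex ℝ {C : Fin n → ℝ | ∀ i, 0 ≤ C i} := convex_Ici (0 : Fin n → ℝ)
  let L : (Fin n → ℝ) →ₗ[ℝ] ℝ := ∑ i, LinearMap.proj i
  have hL : ⇑L = fun C => ∑ i, C i := by
    ext C
    simp [L]
  have hS : ConvexOn ℝ {C : Fin n → ℝ | ∀ i, 0 ≤ C i} fun C => ∑ i, C i := hL ▸ L.convexOn hs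
  have hS' : ConcaveOn ℝ {C : Fin n → ℝ | ∀ i, 0 ≤ C i} fun C => ∑ i, C i :=
    hL ▸ L.concaveOn hs
  have hday (t : Fin T) := ConvexOn.integral_of_forall (μ := μ) hs
    (fun ω => convexOn_daily_cost
      (concaveOn_sum_min hs fun i => max (X i t ω - a i * Y i t ω) 0) hS'
      πin (∑ i, max (a i * Y i t ω - X i t ω) 0) (hβ t) h1 h2 h3)
    (fun C => by
      have hq : Integrable (fun ω => ∑ i, max (a i * Y i t ω - X i t ω) 0) μ :=
        integrable_finsetSum _ fun i _ => (((hY i t).const_mul (a i)).sub (hX i t)).pos_part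
      have hP : Integrable
          (fun ω => ∑ i, min (max (X i t ω - a i * Y i t ω) 0) (C i)) μ :=
        integrable_finsetSum _ fun i _ =>
          (((hX i t).sub ((hY i t).const_mul (a i))).pos_part).inf (integrable_const (C i))
      exact (((hq.const_mul πin).sub (hP.const_mul πout)).add
        (((hP.sub hq).sub (integrable_const _)).pos_part.const_mul πgrid)).add
        (((hq.sub hP).sub (integrable_const _)).pos_part.const_mul πrev))
  refine (hS.smul hB).add ⟨hs, fun x hx y hy u v hu hv huv => ?_⟩
  simp only [smul_eq_mul, Finset.mul_sum (s := (Finset.univ : Finset (Fin T)))]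
  rw [← Finset.sum_add_distrib]
  exact Finset.sum_le_sum fun t _ => (hday t).2 hx hy hu hv huv
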